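/- Assume B : (0,∞) → [0,∞) is continuous and bounded on some neighborhood of 0. Let µ₀ = µ₀⁺ − µ₀⁻ be a weighted signed measure and let (µ_t)_{t≥0} be any measure solution of the mitosis equation with initial datum µ₀. Then for every t ≥ 0 and every continuous f : (0,∞) → ℝ with f(x)/x → 0 as x → 0 and as x → ∞, one has µ_t(f) = µ₀(M_t f) = µ₀⁺(M_t f) − µ₀⁻(M_t f); in particular the measure solution with given initial datum is unique. -/

import Mathlib

open MeasureTheory Real Set Filter Topology

noncomputable section

/-- A function on `(0,∞)` is locally bounded if it is bounded on the intersection of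
`(0,∞)` with every bounded set. -/
def LocBddOn (f : ℝ → ℝ) : Prop :=
  ∀ r > 0, ∃ C, ∀ x, 0 < x → x ≤ r → |f x| ≤ C

/-- A function on `[0,∞) × (0,∞)` is locally bounded if it is bounded on the intersection of
`[0,∞) × (0,∞)` with every bounded set. -/
def LocBdd2 (φ : ℝ → ℝ → ℝ) : Prop :=
  ∀ r > 0, ∃ C, ∀ t x, 0 ≤ t → t ≤ r → 0 < x → x ≤ r → |φ t x| ≤ C

/-- Mild solution of the dual mitosis equation with initial datum `f`. -/
def IsMildSol (B f : ℝ → ℝ) (φ : ℝ → ℝ → ℝ) : Prop :=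
  ∀ t ≥ 0, ∀ x > 0,
    φ t x = f (x * exp t) * Real.exp (-∫ s in (0:ℝ)..t, B (x * exp s))
      + 2 * ∫ τ in (0:ℝ)..t,
          B (x * exp τ) * Real.exp (-∫ s in (0:ℝ)..τ, B (x * exp s)) * φ (t - τ) (x * exp τ / 2)

/-- `B : (0,∞) → [0,∞)` is continuous and bounded on some neighborhood of `0`. -/
def Bhyp (B : ℝ → ℝ) : Prop :=
  ContinuousOn B (Ioi 0) ∧ (∀ x > 0, 0 ≤ B x) ∧
    ∃ ε > 0, ∃ C, ∀ x, 0 < x → x < ε → B x ≤ C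



/-- integrated rate along a characteristic -/
def SS (β : ℝ → ℝ) (t u : ℝ) : ℝ := ∫ r in (0:ℝ)..t, β (u - r)

/-- the mild operator in logarithmic characteristic coordinates -/
def TT (β F : ℝ → ℝ) (P : ℝ → ℝ → ℝ) (t u : ℝ) : ℝ :=
  exp (-SS β t u) * (F u + 2 * ∫ σ in (0:ℝ)..t, β (u - σ) * exp (SS β σ u) * P σ (u - Real.log 2))

lemma aesm_prim (w : ℝ → ℝ) (T : ℝ) :
    AEStronglyMeasurable (fun t => ∫ s in (0:ℝ)..t, w s) (volume.restrict (Ioc 0 T)) := by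
  set I : Set ℝ := {t | 0 ≤ t ∧ IntegrableOn w (Ioc 0 t) volume} with hI
  have hIm : MeasurableSet I := by
    apply Set.OrdConnected.measurableSet
    refine ⟨fun a ha b hb c hc => ⟨ha.1.trans hc.1, hb.2.mono_set (Ioc_subset_Ioc_right hc.2)⟩⟩
  have m1 : Measurable (fun t => ∫⁻ s in Ioc 0 t, ENNReal.ofReal (w s)) := by
    apply Monotone.measurable
    intro a b hab
    exact lintegral_mono_set (Ioc_subset_Ioc_right hab)
  have m2 : Measurable (fun t => ∫⁻ s in Ioc 0 t, ENNReal.ofReal (-w s)) := by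
    apply Monotone.measurable
    intro a b hab
    exact lintegral_mono_set (Ioc_subset_Ioc_right hab)
  have m3 : Measurable (I.indicator (fun t => (∫⁻ s in Ioc 0 t, ENNReal.ofReal (w s)).toReal
      - (∫⁻ s in Ioc 0 t, ENNReal.ofReal (-w s)).toReal)) :=
    (m1.ennreal_toReal.sub m2.ennreal_toReal).indicator hIm
  refine ⟨_, m3.stronglyMeasurable, ?_⟩
  refine (ae_restrict_iff' measurableSet_Ioc).2 (Eventually.of_forall fun t ht => ?_)
  by_cases h : t ∈ I
  · show ∫ s in (0:ℝ)..t, w s = _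
    rw [indicator_of_mem h, intervalIntegral.integral_of_le h.1,
      integral_eq_lintegral_pos_part_sub_lintegral_neg_part h.2]
  · show ∫ s in (0:ℝ)..t, w s = _
    rw [indicator_of_notMem h, intervalIntegral.integral_of_le ht.1.le]
    apply integral_undef
    intro h'
    exact h ⟨ht.1.le, h'⟩

section reg
variable {β F : ℝ → ℝ}

lemma SS_cont (hβ : Continuous β) : Continuous (fun p : ℝ × ℝ => SS β p.1 p.2) := by
  have := intervalIntegral.continuous_parametric_primitive_of_continuous (μ := volume) (a₀ := 0)
    (f := fun u r => β (u - r)) (by fun_prop)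
  exact this.comp continuous_swap

lemma SS_deriv (hβ : Continuous β) (t u : ℝ) : HasDerivAt (fun t => SS β t u) (β (u - t)) t := by
  have hc : Continuous (fun r => β (u - r)) := by fun_prop
  exact intervalIntegral.integral_hasDerivAt_right (hc.intervalIntegrable _ _)
    (hc.stronglyMeasurableAtFilter _ _) hc.continuousAt

lemma SS_mono (hβ : Continuous β) (h0 : ∀ v, 0 ≤ β v) (u : ℝ) : Monotone (fun t => SS β t u) :=
  monotone_of_deriv_nonneg (fun t => (SS_deriv hβ t u).differentiableAt)
    (fun t => by rw [(SS_deriv hβ t u).deriv]; exact h0 _)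

lemma SS_zero (u : ℝ) : SS β 0 u = 0 := by simp [SS]

lemma ker_int (hβ : Continuous β) (t u : ℝ) :
    ∫ σ in (0:ℝ)..t, β (u - σ) * exp (SS β σ u) = exp (SS β t u) - 1 := by
  have h := intervalIntegral.integral_eq_sub_of_hasDerivAt (a := 0) (b := t)
    (f := fun σ => exp (SS β σ u)) (f' := fun σ => exp (SS β σ u) * β (u - σ))
    (fun x _ => (SS_deriv hβ x u).exp) (by
      have := SS_cont hβ
      have h2 : Continuous fun σ => SS β σ u := this.comp (by fun_prop : Continuous fun σ : ℝ => (σ, u))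
      exact Continuous.intervalIntegrable (by fun_prop) _ _)
  simp only [SS_zero, exp_zero] at h
  rw [← h]
  congr 1; ext σ; ring

lemma TT_cont (hβ : Continuous β) (hF : Continuous F) {P : ℝ → ℝ → ℝ}
    (hP : Continuous (fun p : ℝ × ℝ => P p.1 p.2)) :
    Continuous (fun p : ℝ × ℝ => TT β F P p.1 p.2) := by
  have hS := SS_cont hβ
  have h1 : Continuous (fun p : ℝ × ℝ => ∫ σ in (0:ℝ)..p.2,
      β (p.1 - σ) * exp (SS β σ p.1) * P σ (p.1 - Real.log 2)) := by
    apply intervalIntegral.continuous_parametric_primitive_of_continuous (μ := volume) (a₀ := 0)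
      (f := fun u σ => β (u - σ) * exp (SS β σ u) * P σ (u - Real.log 2))
    have a1 : Continuous (fun p : ℝ × ℝ => SS β p.2 p.1) := hS.comp continuous_swap
    have a2 : Continuous (fun p : ℝ × ℝ => P p.2 (p.1 - Real.log 2)) :=
      hP.comp (by fun_prop : Continuous fun p : ℝ × ℝ => (p.2, p.1 - Real.log 2))
    simp only [Function.uncurry_def]
    fun_prop
  have h2 := h1.comp continuous_swap
  simp only [Function.comp_def, Prod.fst_swap, Prod.snd_swap] at h2
  unfold TT
  fun_prop

lemma TT_bound (hβ : Continuous β) (h0 : ∀ v, 0 ≤ β v) {C : ℝ} (hC : ∀ u, |F u| ≤ C * exp u)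
    {P : ℝ → ℝ → ℝ} (hPb : ∀ t ≥ 0, ∀ u, |P t u| ≤ C * exp u) :
    ∀ t ≥ 0, ∀ u, |TT β F P t u| ≤ C * exp u := by
  intro t ht u
  have hS : Continuous fun σ => SS β σ u :=
    (SS_cont hβ).comp (by fun_prop : Continuous fun σ : ℝ => (σ, u))
  have hi : |∫ σ in (0:ℝ)..t, β (u - σ) * exp (SS β σ u) * P σ (u - Real.log 2)|
      ≤ ∫ σ in (0:ℝ)..t, β (u - σ) * exp (SS β σ u) * (C * exp u / 2) := by
    rw [← Real.norm_eq_abs]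
    apply intervalIntegral.norm_integral_le_of_norm_le ht
    · refine Eventually.of_forall fun σ hσ => ?_
      have := hPb σ hσ.1.le (u - Real.log 2)
      rw [exp_sub, exp_log two_pos] at this
      rw [norm_mul, Real.norm_of_nonneg (mul_nonneg (h0 _) (exp_pos _).le), Real.norm_eq_abs]
      apply mul_le_mul_of_nonneg_left _ (mul_nonneg (h0 _) (exp_pos _).le)
      linarith
    · exact Continuous.intervalIntegrable (by fun_prop) _ _
  rw [intervalIntegral.integral_mul_const, ker_int hβ] at hi
  unfold TT
  rw [abs_mul, abs_of_pos (exp_pos _)]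
  have h3 : |F u + 2 * ∫ σ in (0:ℝ)..t, β (u - σ) * exp (SS β σ u) * P σ (u - Real.log 2)|
      ≤ exp (SS β t u) * (C * exp u) := by
    refine (abs_add_le _ _).trans ?_
    rw [abs_mul, abs_two]
    have := hC u
    nlinarith
  calc _ ≤ exp (-SS β t u) * (exp (SS β t u) * (C * exp u)) := by gcongr
    _ = _ := by rw [← mul_assoc, ← exp_add]; simp

/-- Picard iterates -/
def PP (β F : ℝ → ℝ) : ℕ → ℝ → ℝ → ℝ
  | 0 => fun _ _ => 0
  | n+1 => TT β F (PP β F n)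

lemma G_meas (hβ : Continuous β) {G : ℝ → ℝ → ℝ}
    (hG : ∀ t ≥ 0, ∀ u, G t u = TT β F G t u) (u T : ℝ) :
    AEStronglyMeasurable (fun t => G t u) (volume.restrict (Ioc 0 T)) := by
  have hS : Continuous fun σ => SS β σ u :=
    (SS_cont hβ).comp (by fun_prop : Continuous fun σ : ℝ => (σ, u))
  have h : AEStronglyMeasurable (fun t => TT β F G t u) (volume.restrict (Ioc 0 T)) := by
    unfold TT
    exact (by fun_prop : Continuous fun t => exp (-SS β t u)).aestronglyMeasurable.mul
      (((aesm_prim _ T).const_mul 2).const_add (F u))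
  exact h.congr ((ae_restrict_iff' measurableSet_Ioc).2
    (Eventually.of_forall fun t ht => (hG t ht.1.le u).symm))

lemma G_intb (hβ : Continuous β) {G : ℝ → ℝ → ℝ}
    (hG : ∀ t ≥ 0, ∀ u, G t u = TT β F G t u)
    (hb : ∀ r, ∃ D, ∀ t u, 0 ≤ t → t ≤ r → u ≤ r → |G t u| ≤ D) (u t : ℝ) (ht : 0 ≤ t) (v : ℝ) :
    IntervalIntegrable (fun σ => β (u - σ) * exp (SS β σ u) * G σ v) volume 0 t := by
  have hS : Continuous fun σ => SS β σ u :=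
    (SS_cont hβ).comp (by fun_prop : Continuous fun σ : ℝ => (σ, u))
  apply IntervalIntegrable.continuousOn_mul _ (by fun_prop)
  rw [intervalIntegrable_iff_integrableOn_Ioc_of_le ht]
  obtain ⟨D, hD⟩ := hb (max t v)
  refine Integrable.of_bound (G_meas hβ hG v t) D ?_
  refine (ae_restrict_iff' measurableSet_Ioc).2 (Eventually.of_forall fun s hs => ?_)
  exact hD s v hs.1.le (hs.2.trans (le_max_left _ _)) (le_max_right _ _)

lemma PP_cont (hβ : Continuous β) (hF : Continuous F) (n : ℕ) :
    Continuous (fun p : ℝ × ℝ => PP β F n p.1 p.2) := by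
  induction n with
  | zero => exact continuous_const
  | succ n ih => exact TT_cont hβ hF ih

lemma PP_bound (hβ : Continuous β) (h0 : ∀ v, 0 ≤ β v) {C : ℝ} (hC : ∀ u, |F u| ≤ C * exp u)
    (n : ℕ) : ∀ t ≥ 0, ∀ u, |PP β F n t u| ≤ C * exp u := by
  induction n with
  | zero =>
    intro t _ u
    simp only [PP, abs_zero]
    exact (abs_nonneg _).trans (hC u)
  | succ n ih => exact TT_bound hβ h0 hC ih

lemma GP_diff (hβ : Continuous β) (h0 : ∀ v, 0 ≤ β v) (hF : Continuous F) {G : ℝ → ℝ → ℝ}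
    (hG : ∀ t ≥ 0, ∀ u, G t u = TT β F G t u)
    (hb : ∀ r, ∃ D, ∀ t u, 0 ≤ t → t ≤ r → u ≤ r → |G t u| ≤ D)
    (r K D : ℝ) (hK : ∀ v ≤ r, β v ≤ K) (hD : ∀ t u, 0 ≤ t → t ≤ r → u ≤ r → |G t u| ≤ D)
    (n : ℕ) : ∀ t u, 0 ≤ t → t ≤ r → u ≤ r →
      |G t u - PP β F n t u| ≤ D * (2 * K * t) ^ n / n.factorial := by
  induction n with
  | zero => intro t u h1 h2 h3; simpa [PP] using hD t u h1 h2 h3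
  | succ n ih =>
    intro t u h1 h2 h3
    have hS : Continuous fun σ => SS β σ u :=
      (SS_cont hβ).comp (by fun_prop : Continuous fun σ : ℝ => (σ, u))
    have hPc : Continuous fun σ => PP β F n σ (u - Real.log 2) :=
      (PP_cont hβ hF n).comp (by fun_prop : Continuous fun σ : ℝ => (σ, u - Real.log 2))
    have hl : 0 < Real.log 2 := Real.log_pos (by norm_num)
    have e1 : G t u - PP β F (n+1) t u = 2 * ∫ σ in (0:ℝ)..t,
        exp (-SS β t u) * (β (u - σ) * exp (SS β σ u) * G σ (u - Real.log 2)
          - β (u - σ) * exp (SS β σ u) * PP β F n σ (u - Real.log 2)) := by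
      rw [intervalIntegral.integral_const_mul, intervalIntegral.integral_sub
        (G_intb hβ hG hb u t h1 _) (Continuous.intervalIntegrable (by fun_prop) _ _), hG t h1 u]
      simp only [PP, TT]
      ring
    have hK0 : 0 ≤ K := (h0 _).trans (hK r le_rfl)
    have hi : |∫ σ in (0:ℝ)..t,
        exp (-SS β t u) * (β (u - σ) * exp (SS β σ u) * G σ (u - Real.log 2)
          - β (u - σ) * exp (SS β σ u) * PP β F n σ (u - Real.log 2))|
        ≤ ∫ σ in (0:ℝ)..t, (K * D * (2 * K) ^ n / n.factorial) * σ ^ n := by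
      rw [← Real.norm_eq_abs]
      apply intervalIntegral.norm_integral_le_of_norm_le h1
      · refine Eventually.of_forall fun σ hσ => ?_
        have a1 := ih σ (u - Real.log 2) hσ.1.le (hσ.2.trans h2) (by linarith)
        have a2 : exp (-SS β t u) * exp (SS β σ u) ≤ 1 := by
          rw [← exp_add, exp_le_one_iff]
          have := SS_mono hβ h0 u hσ.2
          simp only at this
          linarith
        have a3 := hK (u - σ) (by linarith [hσ.1])
        have a4 := h0 (u - σ)
        have : exp (-SS β t u) * (β (u - σ) * exp (SS β σ u) * G σ (u - Real.log 2)
          - β (u - σ) * exp (SS β σ u) * PP β F n σ (u - Real.log 2))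
          = β (u - σ) * (exp (-SS β t u) * exp (SS β σ u)) *
            (G σ (u - Real.log 2) - PP β F n σ (u - Real.log 2)) := by ring
        rw [this, norm_mul, norm_mul, Real.norm_of_nonneg a4,
          Real.norm_of_nonneg (by positivity), Real.norm_eq_abs]
        calc _ ≤ K * 1 * (D * (2 * K * σ) ^ n / n.factorial) := by gcongr
          _ = _ := by rw [mul_pow]; ring
      · exact Continuous.intervalIntegrable (by fun_prop) _ _
    rw [e1, abs_mul, abs_two]
    calc _ ≤ 2 * ∫ σ in (0:ℝ)..t, (K * D * (2 * K) ^ n / n.factorial) * σ ^ n := by gcongr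
      _ = _ := by
        rw [intervalIntegral.integral_const_mul, integral_pow, Nat.factorial_succ]
        push_cast
        have : (n.factorial : ℝ) ≠ 0 := by positivity
        field_simp
        simp
        ring

lemma GP_lim (hβ : Continuous β) (h0 : ∀ v, 0 ≤ β v) (hF : Continuous F)
    (hK : ∀ r, ∃ K, ∀ v ≤ r, β v ≤ K) {G : ℝ → ℝ → ℝ}
    (hG : ∀ t ≥ 0, ∀ u, G t u = TT β F G t u)
    (hb : ∀ r, ∃ D, ∀ t u, 0 ≤ t → t ≤ r → u ≤ r → |G t u| ≤ D) (r : ℝ) :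
    TendstoUniformlyOn (fun n (p : ℝ × ℝ) => PP β F n p.1 p.2) (fun p => G p.1 p.2) atTop
      (Icc 0 r ×ˢ Iic r) := by
  obtain ⟨K, hK⟩ := hK r
  obtain ⟨D, hD⟩ := hb r
  have hK0 : 0 ≤ K := (h0 _).trans (hK r le_rfl)
  rw [Metric.tendstoUniformlyOn_iff]
  intro ε hε
  have hl : Tendsto (fun n : ℕ => D * ((2 * K * r) ^ n / n.factorial)) atTop (𝓝 (D * 0)) :=
    (FloorSemiring.tendsto_pow_div_factorial_atTop (2 * K * r)).const_mul D
  rw [mul_zero] at hl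
  filter_upwards [hl.eventually (gt_mem_nhds hε)] with n hn p hp
  have hp1 : 0 ≤ p.1 := hp.1.1
  have hp2 : p.1 ≤ r := hp.1.2
  have := GP_diff hβ h0 hF hG hb r K D hK hD n p.1 p.2 hp1 hp2 hp.2
  have hD0 : 0 ≤ D := (abs_nonneg _).trans (hD p.1 p.2 hp1 hp2 hp.2)
  rw [Real.dist_eq]
  refine this.trans_lt (lt_of_le_of_lt ?_ hn)
  rw [mul_div_assoc]
  gcongr

lemma G_cont (hβ : Continuous β) (h0 : ∀ v, 0 ≤ β v) (hF : Continuous F)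
    (hK : ∀ r, ∃ K, ∀ v ≤ r, β v ≤ K) {G : ℝ → ℝ → ℝ}
    (hG : ∀ t ≥ 0, ∀ u, G t u = TT β F G t u)
    (hb : ∀ r, ∃ D, ∀ t u, 0 ≤ t → t ≤ r → u ≤ r → |G t u| ≤ D) :
    ContinuousOn (fun p : ℝ × ℝ => G p.1 p.2) (Ici 0 ×ˢ univ) := by
  rintro ⟨t, u⟩ ⟨ht, -⟩
  set r := max t u + 1
  have h := (GP_lim hβ h0 hF hK hG hb r).continuousOn
    (Eventually.of_forall fun n => (PP_cont hβ hF n).continuousOn).frequently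
  have h1 : t < r := by have := le_max_left t u; simp only [r]; linarith
  have h2 : u < r := by have := le_max_right t u; simp only [r]; linarith
  refine (h (t, u) ⟨⟨ht, h1.le⟩, h2.le⟩).mono_of_mem_nhdsWithin ?_
  rw [mem_nhdsWithin]
  refine ⟨Iio r ×ˢ Iio r, isOpen_Iio.prod isOpen_Iio, ⟨h1, h2⟩, ?_⟩
  rintro ⟨a, b⟩ ⟨⟨ha, hb'⟩, ⟨hc, -⟩⟩
  exact ⟨⟨hc, le_of_lt ha⟩, mem_Iic.2 (le_of_lt hb')⟩

lemma G_bound (hβ : Continuous β) (h0 : ∀ v, 0 ≤ β v) (hF : Continuous F)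
    (hK : ∀ r, ∃ K, ∀ v ≤ r, β v ≤ K) {G : ℝ → ℝ → ℝ}
    (hG : ∀ t ≥ 0, ∀ u, G t u = TT β F G t u)
    (hb : ∀ r, ∃ D, ∀ t u, 0 ≤ t → t ≤ r → u ≤ r → |G t u| ≤ D)
    {C : ℝ} (hC : ∀ u, |F u| ≤ C * exp u) : ∀ t ≥ 0, ∀ u, |G t u| ≤ C * exp u := by
  intro t ht u
  have h := (GP_lim hβ h0 hF hK hG hb (max t u)).tendsto_at (x := (t, u))
    ⟨⟨ht, le_max_left _ _⟩, mem_Iic.2 (le_max_right _ _)⟩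
  exact le_of_tendsto h.abs (Eventually.of_forall fun n => PP_bound hβ h0 hC n t ht u)

end reg


/-- continuous kernels supported in `(0,R)` -/
def Ker (R : ℝ) (κ : ℝ → ℝ) : Prop := Continuous κ ∧ ∀ r, r ∉ Ioo 0 R → κ r = 0

/-- time-averaged solution, in logarithmic coordinates -/
def FK (G : ℝ → ℝ → ℝ) (R : ℝ) (κ : ℝ → ℝ) (v : ℝ) : ℝ := ∫ r in (0:ℝ)..R, κ r * G r (v + r)

section avg
variable {β F : ℝ → ℝ} {G : ℝ → ℝ → ℝ}

lemma TT_deriv (hβ : Continuous β) (hGc : Continuous (fun p : ℝ × ℝ => G p.1 p.2)) (t u : ℝ) :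
    HasDerivAt (fun t => TT β F G t u)
      (β (u - t) * (2 * G t (u - Real.log 2) - TT β F G t u)) t := by
  have hS : Continuous fun σ => SS β σ u :=
    (SS_cont hβ).comp (by fun_prop : Continuous fun σ : ℝ => (σ, u))
  have hg : Continuous fun σ => G σ (u - Real.log 2) :=
    hGc.comp (by fun_prop : Continuous fun σ : ℝ => (σ, u - Real.log 2))
  have hc : Continuous fun σ => β (u - σ) * exp (SS β σ u) * G σ (u - Real.log 2) := by fun_prop
  have h1 := intervalIntegral.integral_hasDerivAt_right (hc.intervalIntegrable 0 t)
    (hc.stronglyMeasurableAtFilter _ _) hc.continuousAt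
  have h2 := ((SS_deriv hβ t u).neg.exp).mul ((h1.const_mul 2).const_add (F u))
  refine h2.congr_deriv ?_
  simp only [TT]
  have : exp (-SS β t u) * exp (SS β t u) = 1 := by rw [← exp_add]; simp
  linear_combination (2 * β (u - t) * G t (u - Real.log 2)) * this

lemma FK_cont (hGc : Continuous (fun p : ℝ × ℝ => G p.1 p.2)) (R : ℝ) {κ : ℝ → ℝ}
    (hκ : Continuous κ) : Continuous (FK G R κ) := by
  unfold FK
  apply intervalIntegral.continuous_parametric_intervalIntegral_of_continuous'
    (f := fun v r => κ r * G r (v + r))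
  have : Continuous (fun p : ℝ × ℝ => G p.2 (p.1 + p.2)) :=
    hGc.comp (by fun_prop : Continuous fun p : ℝ × ℝ => (p.2, p.1 + p.2))
  simp only [Function.uncurry_def]
  fun_prop

lemma Ker.int_eq {R : ℝ} (hR : 0 < R) {κ : ℝ → ℝ} (hκ : Ker R κ) (g : ℝ → ℝ) {a b : ℝ} (ha : a ≤ 0)
    (hb : R ≤ b) : ∫ r in a..b, κ r * g r = ∫ r in (0:ℝ)..R, κ r * g r := by
  have hs : Function.support (fun r => κ r * g r) ⊆ Ioc 0 R := by
    intro r hr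
    by_contra h
    apply hr
    simp only
    rw [hκ.2 r (fun h' => h ⟨h'.1, h'.2.le⟩), zero_mul]
  rw [intervalIntegral.integral_eq_integral_of_support_subset hs,
    intervalIntegral.integral_eq_integral_of_support_subset
      (hs.trans (Ioc_subset_Ioc ha hb))]

lemma FK_deriv (hβ : Continuous β) (hF : Continuous F)
    (hGc : Continuous (fun p : ℝ × ℝ => G p.1 p.2))
    (hG : ∀ t ≥ 0, ∀ u, G t u = TT β F G t u) {R : ℝ} (hR : 0 < R) {κ κ' : ℝ → ℝ}
    (hκ : Ker R κ) (hκ' : Ker R κ') (hd : ∀ r, HasDerivAt κ (κ' r) r) (v : ℝ) :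
    HasDerivAt (FK G R κ)
      (-FK G R κ' v - β v * (2 * FK G R κ (v - Real.log 2) - FK G R κ v)) v := by
  have hκc := hκ.1
  have hκc' := hκ'.1
  set H := TT β F G with hH
  have hHc : Continuous (fun p : ℝ × ℝ => H p.1 p.2) := TT_cont hβ hF hGc
  set a := v - 1
  set b := v + 1 + R
  have rep : ∀ κ, Ker R κ → ∀ w ∈ Metric.ball v 1,
      FK G R κ w = ∫ u in a..b, κ (u - w) * H (u - w) u := by
    intro κ hκ w hw
    rw [Metric.mem_ball, Real.dist_eq, abs_lt] at hw
    have e := intervalIntegral.integral_comp_sub_right (a := a) (b := b)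
      (fun r => κ r * H r (w + r)) w
    simp only [add_sub_cancel] at e
    rw [e, hκ.int_eq hR (fun r => H r (w + r)) (by simp only [a]; linarith)
      (by simp only [b]; linarith)]
    unfold FK
    apply intervalIntegral.integral_congr
    intro r hr
    rw [uIcc_of_le hR.le] at hr
    simp only
    rw [hG r hr.1]
  set Fw : ℝ → ℝ → ℝ := fun w u => κ (u - w) * H (u - w) u with hFw
  set Fw' : ℝ → ℝ → ℝ := fun w u => -(κ' (u - w) * H (u - w) u +
    κ (u - w) * (β w * (2 * G (u - w) (u - Real.log 2) - H (u - w) u))) with hFw'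
  have c1 : Continuous (fun p : ℝ × ℝ => Fw p.1 p.2) := by
    have : Continuous (fun p : ℝ × ℝ => H (p.2 - p.1) p.2) :=
      hHc.comp (by fun_prop : Continuous fun p : ℝ × ℝ => (p.2 - p.1, p.2))
    simp only [Fw]
    fun_prop
  have c2 : Continuous (fun p : ℝ × ℝ => Fw' p.1 p.2) := by
    have h1 : Continuous (fun p : ℝ × ℝ => H (p.2 - p.1) p.2) :=
      hHc.comp (by fun_prop : Continuous fun p : ℝ × ℝ => (p.2 - p.1, p.2))
    have h2 : Continuous (fun p : ℝ × ℝ => G (p.2 - p.1) (p.2 - Real.log 2)) :=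
      hGc.comp (by fun_prop : Continuous fun p : ℝ × ℝ => (p.2 - p.1, p.2 - Real.log 2))
    simp only [Fw']
    fun_prop
  have c1' : ∀ w, Continuous (Fw w) := fun w =>
    c1.comp (by fun_prop : Continuous fun u : ℝ => (w, u))
  have c2' : ∀ w, Continuous (Fw' w) := fun w =>
    c2.comp (by fun_prop : Continuous fun u : ℝ => (w, u))
  obtain ⟨D, hD⟩ := ((isCompact_closedBall v 1).prod (isCompact_uIcc (a := a) (b := b))).exists_bound_of_continuousOn
    c2.continuousOn
  have key := (intervalIntegral.hasDerivAt_integral_of_dominated_loc_of_deriv_le (μ := volume)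
    (a := a) (b := b) (F := Fw) (F' := Fw') (x₀ := v) (s := Metric.ball v 1) (bound := fun _ => D)
    (Metric.ball_mem_nhds v one_pos)
    (Eventually.of_forall fun w => (c1' w).aestronglyMeasurable)
    ((c1' v).intervalIntegrable _ _) (c2' v).aestronglyMeasurable
    (Eventually.of_forall fun u hu w hw => hD (w, u)
      ⟨Metric.ball_subset_closedBall hw, uIoc_subset_uIcc hu⟩)
    intervalIntegrable_const
    (Eventually.of_forall fun u hu w hw => by
      have d1 : HasDerivAt (fun w => u - w) (-1) w := by
        simpa using (hasDerivAt_id w).const_sub u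
      have d2 := (hd (u - w)).comp w d1
      have d3 := (TT_deriv (F := F) hβ hGc (u - w) u).comp w d1
      refine (d2.mul d3).congr_deriv ?_
      simp only [Fw', Function.comp_def, sub_sub_cancel, ← hH]
      ring)).2
  have key2 : HasDerivAt (FK G R κ) (∫ u in a..b, Fw' v u) v := by
    refine key.congr_of_eventuallyEq ?_
    filter_upwards [Metric.ball_mem_nhds v one_pos] with w hw
    exact rep κ hκ w hw
  refine key2.congr_deriv ?_
  have hv : v ∈ Metric.ball v 1 := Metric.mem_ball_self one_pos
  have e3 : FK G R κ (v - Real.log 2) = ∫ u in a..b, κ (u - v) * G (u - v) (u - Real.log 2) := by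
    have e := intervalIntegral.integral_comp_sub_right (a := a) (b := b)
      (fun r => κ r * G r (v - Real.log 2 + r)) v
    have : ∀ u : ℝ, v - Real.log 2 + (u - v) = u - Real.log 2 := fun u => by ring
    simp only [this] at e
    rw [e, hκ.int_eq hR (fun r => G r (v - Real.log 2 + r)) (by simp only [a]; linarith)
      (by simp only [b]; linarith)]
    rfl
  rw [rep κ hκ v hv, rep κ' hκ' v hv, e3]
  have i1 : Continuous (fun u : ℝ => H (u - v) u) :=
      hHc.comp (by fun_prop : Continuous fun u : ℝ => (u - v, u))
  have i2 : Continuous (fun u : ℝ => G (u - v) (u - Real.log 2)) :=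
      hGc.comp (by fun_prop : Continuous fun u : ℝ => (u - v, u - Real.log 2))
  rw [← intervalIntegral.integral_const_mul, ← intervalIntegral.integral_sub,
    ← intervalIntegral.integral_const_mul, ← intervalIntegral.integral_neg,
    ← intervalIntegral.integral_sub]
  · congr 1; ext u; simp only [Fw']; ring
  all_goals exact Continuous.intervalIntegrable (by fun_prop) _ _

lemma FK_bound {C : ℝ} (hC : ∀ t ≥ 0, ∀ u, |G t u| ≤ C * exp u) {R : ℝ} (hR : 0 < R) {κ : ℝ → ℝ}
    {m : ℝ} (hm : ∀ r, |κ r| ≤ m) (v : ℝ) : |FK G R κ v| ≤ m * (C * exp R * R) * exp v := by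
  have hC0 : 0 ≤ C := by
    have := (abs_nonneg _).trans (hC 0 le_rfl 0)
    simpa using this
  have hm0 : 0 ≤ m := (abs_nonneg _).trans (hm 0)
  unfold FK
  have := intervalIntegral.norm_integral_le_of_norm_le_const (a := 0) (b := R)
    (f := fun r => κ r * G r (v + r)) (C := m * (C * exp (v + R))) (by
      intro r hr
      rw [uIoc_of_le hR.le] at hr
      rw [norm_mul]
      apply mul_le_mul (hm r) _ (norm_nonneg _) hm0
      refine (hC r hr.1.le _).trans ?_
      gcongr
      exact hr.2)
  rw [Real.norm_eq_abs] at this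
  refine this.trans (le_of_eq ?_)
  rw [exp_add, sub_zero, abs_of_pos hR]
  ring

lemma FK_sub (hGc : Continuous (fun p : ℝ × ℝ => G p.1 p.2)) (R : ℝ) {κ₁ κ₂ : ℝ → ℝ}
    (h1 : Continuous κ₁) (h2 : Continuous κ₂) (v : ℝ) :
    FK G R (fun r => κ₁ r - κ₂ r) v = FK G R κ₁ v - FK G R κ₂ v := by
  have : Continuous (fun r : ℝ => G r (v + r)) :=
    hGc.comp (by fun_prop : Continuous fun r : ℝ => (r, v + r))
  unfold FK
  rw [← intervalIntegral.integral_sub (Continuous.intervalIntegrable (by fun_prop) _ _)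
    (Continuous.intervalIntegrable (by fun_prop) _ _)]
  congr 1; ext r; ring

lemma FK_smul (R c : ℝ) (κ : ℝ → ℝ) (v : ℝ) :
    FK G R (fun r => c * κ r) v = c * FK G R κ v := by
  unfold FK
  rw [← intervalIntegral.integral_const_mul]
  congr 1; ext r; ring

end avg


/-- action of a difference of measures -/
def LL (p m : Measure ℝ) (f : ℝ → ℝ) : ℝ := (∫ x in Ioi 0, f x ∂p) - ∫ x in Ioi 0, f x ∂m

/-- continuous functions dominated by `C x` -/
def Adm (C : ℝ) (f : ℝ → ℝ) : Prop := ContinuousOn f (Ioi 0) ∧ ∀ x > 0, |f x| ≤ C * x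

lemma id_int {p : Measure ℝ} (hp : ∫⁻ x in Ioi 0, ENNReal.ofReal x ∂p < ⊤) :
    Integrable (fun x : ℝ => x) (p.restrict (Ioi 0)) := by
  refine ⟨measurable_id.aestronglyMeasurable, ?_⟩
  rw [hasFiniteIntegral_iff_norm]
  refine lt_of_le_of_lt (le_of_eq ?_) hp
  apply setLIntegral_congr_fun measurableSet_Ioi
  intro x hx
  simp only [Real.norm_eq_abs]
  rw [abs_of_pos hx]

lemma Adm.int {C : ℝ} {f : ℝ → ℝ} (hf : Adm C f) {p : Measure ℝ}
    (hp : ∫⁻ x in Ioi 0, ENNReal.ofReal x ∂p < ⊤) : Integrable f (p.restrict (Ioi 0)) := by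
  refine ((id_int hp).const_mul C).mono' (hf.1.aestronglyMeasurable measurableSet_Ioi) ?_
  exact (ae_restrict_iff' measurableSet_Ioi).2 (Eventually.of_forall fun x hx => hf.2 x hx)

lemma LL_sub {p m : Measure ℝ} (hp : ∫⁻ x in Ioi 0, ENNReal.ofReal x ∂p < ⊤)
    (hm : ∫⁻ x in Ioi 0, ENNReal.ofReal x ∂m < ⊤) {C D : ℝ} {f g : ℝ → ℝ} (hf : Adm C f)
    (hg : Adm D g) : LL p m (fun x => f x - g x) = LL p m f - LL p m g := by
  unfold LL
  rw [integral_sub (hf.int hp) (hg.int hp), integral_sub (hf.int hm) (hg.int hm)]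
  ring

lemma LL_smul {p m : Measure ℝ} (c : ℝ) (f : ℝ → ℝ) :
    LL p m (fun x => c * f x) = c * LL p m f := by
  unfold LL
  rw [integral_const_mul, integral_const_mul]
  ring

lemma LL_congr {p m : Measure ℝ} {f g : ℝ → ℝ} (h : ∀ x > 0, f x = g x) : LL p m f = LL p m g := by
  unfold LL
  rw [setIntegral_congr_fun measurableSet_Ioi (fun x hx => h x hx),
    setIntegral_congr_fun measurableSet_Ioi (fun x hx => h x hx)]

lemma adm_bcf (g : BoundedContinuousFunction ℝ ℝ) : Adm ‖g‖ (fun x => x * g (Real.log x)) := by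
  refine ⟨?_, fun x hx => ?_⟩
  · apply continuousOn_id.mul
    apply g.continuous.comp_continuousOn
    exact continuousOn_log.mono (fun x hx => ne_of_gt hx)
  · rw [abs_mul, abs_of_pos hx, mul_comm]
    exact mul_le_mul_of_nonneg_right (g.norm_coe_le_norm _) (le_of_lt hx)

lemma LL_bound0 {p m : Measure ℝ} (hp : ∫⁻ x in Ioi 0, ENNReal.ofReal x ∂p < ⊤)
    (hm : ∫⁻ x in Ioi 0, ENNReal.ofReal x ∂m < ⊤) {C : ℝ} {f : ℝ → ℝ} (hf : Adm C f) :
    |LL p m f| ≤ ((∫ x in Ioi 0, x ∂p) + ∫ x in Ioi 0, x ∂m) * C := by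
  have h : ∀ q : Measure ℝ, ∫⁻ x in Ioi 0, ENNReal.ofReal x ∂q < ⊤ →
      |∫ x in Ioi 0, f x ∂q| ≤ (∫ x in Ioi 0, x ∂q) * C := by
    intro q hq
    rw [← integral_mul_const, ← Real.norm_eq_abs]
    refine norm_integral_le_of_norm_le ((id_int hq).mul_const C) ?_
    refine (ae_restrict_iff' measurableSet_Ioi).2 (Eventually.of_forall fun x hx => ?_)
    rw [mul_comm]
    exact hf.2 x hx
  unfold LL
  refine (abs_sub _ _).trans ?_
  linarith [h p hp, h m hm]

/-- the functional on bounded continuous functions in logarithmic coordinates -/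
def LB (p m : Measure ℝ) (hp : ∫⁻ x in Ioi 0, ENNReal.ofReal x ∂p < ⊤)
    (hm : ∫⁻ x in Ioi 0, ENNReal.ofReal x ∂m < ⊤) : BoundedContinuousFunction ℝ ℝ →L[ℝ] ℝ :=
  LinearMap.mkContinuous
    { toFun := fun g => LL p m (fun x => x * g (Real.log x))
      map_add' := by
        intro g h
        have := LL_sub hp hm (adm_bcf (g + h)) (adm_bcf h)
        rw [← sub_eq_iff_eq_add, ← this]
        congr 1; ext x
        simp
        ring
      map_smul' := by
        intro c g
        simp only [RingHom.id_apply, smul_eq_mul]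
        rw [← LL_smul]
        congr 1; ext x
        simp
        ring } ((∫ x in Ioi 0, x ∂p) + ∫ x in Ioi 0, x ∂m)
    (fun g => LL_bound0 hp hm (adm_bcf g))

lemma LL_unif {μp μm : ℝ → Measure ℝ}
    (hfin : ∀ t ≥ 0, (∫⁻ x in Ioi 0, ENNReal.ofReal x ∂(μp t)) < ⊤ ∧
      (∫⁻ x in Ioi 0, ENNReal.ofReal x ∂(μm t)) < ⊤)
    (hcont : ∀ f : ℝ → ℝ, ContinuousOn f (Ioi 0) → (∃ C, ∀ x > 0, |f x| ≤ C * x) →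
      ContinuousOn (fun t => LL (μp t) (μm t) f) (Ici 0)) (T : ℝ) :
    ∃ K, 0 ≤ K ∧ ∀ t ∈ Icc 0 T, ∀ C f, Adm C f → |LL (μp t) (μm t) f| ≤ K * C := by
  let g : Icc (0:ℝ) T → (BoundedContinuousFunction ℝ ℝ →L[ℝ] ℝ) := fun t =>
    LB (μp t) (μm t) (hfin t t.2.1).1 (hfin t t.2.1).2
  obtain ⟨K, hK⟩ := banach_steinhaus (g := g) (by
    intro w
    have hc := hcont _ (adm_bcf w).1 ⟨_, (adm_bcf w).2⟩
    obtain ⟨D, hD⟩ := isCompact_Icc.exists_bound_of_continuousOn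
      (hc.mono (Icc_subset_Ici_self : Icc (0:ℝ) T ⊆ Ici 0))
    exact ⟨D, fun t => hD t t.2⟩)
  refine ⟨max K 0, le_max_right _ _, fun t ht C f hf => ?_⟩
  have hC0 : 0 ≤ C := by
    have := (abs_nonneg _).trans (hf.2 1 one_pos)
    simpa using this
  have hwc : Continuous (fun v => f (exp v) / exp v) := by
    refine Continuous.div ?_ (by fun_prop) (fun v => (exp_pos v).ne')
    exact hf.1.comp_continuous (by fun_prop) (fun v => exp_pos v)
  have hwb : ∀ v, ‖f (exp v) / exp v‖ ≤ C := by
    intro v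
    rw [norm_div, Real.norm_eq_abs, Real.norm_of_nonneg (exp_pos v).le, div_le_iff₀ (exp_pos v)]
    exact hf.2 _ (exp_pos v)
  let w : BoundedContinuousFunction ℝ ℝ := BoundedContinuousFunction.ofNormedAddCommGroup _ hwc C hwb
  have hw : ‖w‖ ≤ C := BoundedContinuousFunction.norm_ofNormedAddCommGroup_le _ hC0 hwb
  have e : LL (μp t) (μm t) f = g ⟨t, ht⟩ w := by
    show _ = LL (μp t) (μm t) (fun x => x * w (Real.log x))
    apply LL_congr
    intro x hx
    show f x = x * (f (exp (Real.log x)) / exp (Real.log x))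
    rw [exp_log hx]
    field_simp
  rw [e, ← Real.norm_eq_abs]
  refine ((g ⟨t, ht⟩).le_opNorm w).trans ?_
  exact mul_le_mul ((hK _).trans (le_max_left _ _)) hw (norm_nonneg _) (le_max_right _ _)

lemma quad_const {e : ℝ → ℝ} {T C : ℝ} (hT : 0 ≤ T)
    (h : ∀ t ∈ Icc 0 T, ∀ t' ∈ Icc 0 T, t ≤ t' → |e t' - e t| ≤ C * (t' - t) ^ 2) : e T = e 0 := by
  have h' : ∀ t ∈ Icc 0 T, ∀ t' ∈ Icc 0 T, |e t' - e t| ≤ C * (t' - t) ^ 2 := by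
    intro t ht t' ht'
    rcases le_total t t' with hh | hh
    · exact h t ht t' ht' hh
    · rw [abs_sub_comm]
      exact (h t' ht' t ht hh).trans (le_of_eq (by ring))
  have hd : ∀ x ∈ Icc 0 T, HasDerivWithinAt e 0 (Icc 0 T) x := by
    intro x hx
    rw [hasDerivWithinAt_iff_isLittleO]
    simp only [smul_zero, sub_zero]
    have h1 : (fun x' => e x' - e x) =O[𝓝[Icc 0 T] x] fun x' => (x' - x) ^ 2 := by
      apply Asymptotics.IsBigO.of_bound C
      filter_upwards [self_mem_nhdsWithin] with y hy
      rw [Real.norm_eq_abs, Real.norm_of_nonneg (sq_nonneg _)]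
      exact h' x hx y hy
    refine h1.trans_isLittleO ?_
    have h2 := (Asymptotics.isLittleO_pow_id (𝕜 := ℝ) (n := 2) (by norm_num))
    refine (h2.comp_tendsto (k := fun x' => x' - x) ?_)
    have : Tendsto (fun x' => x' - x) (𝓝 x) (𝓝 (x - x)) := by
      exact (continuous_id.sub continuous_const).tendsto x
    rw [sub_self] at this
    exact this.mono_left nhdsWithin_le_nhds
  rcases hT.eq_or_lt with rfl | hT'
  · rfl
  exact constant_of_derivWithin_zero (fun x hx => (hd x hx).differentiableWithinAt)
    (fun x hx => (hd x (Ico_subset_Icc_self hx)).derivWithin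
      (uniqueDiffOn_Icc hT' x (Ico_subset_Icc_self hx))) T (right_mem_Icc.2 hT)


/-- time averaged solution in the original coordinates -/
def XF (G : ℝ → ℝ → ℝ) (R : ℝ) (κ : ℝ → ℝ) (x : ℝ) : ℝ := FK G R κ (Real.log x)

lemma XF_adm {G : ℝ → ℝ → ℝ} (hGc : Continuous (fun p : ℝ × ℝ => G p.1 p.2)) {C : ℝ}
    (hC : ∀ t ≥ 0, ∀ u, |G t u| ≤ C * exp u) {R : ℝ} (hR : 0 < R) {κ : ℝ → ℝ} (hκ : Continuous κ)
    {m : ℝ} (hm : ∀ r, |κ r| ≤ m) : Adm (m * (C * exp R * R)) (XF G R κ) := by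
  refine ⟨?_, fun x hx => ?_⟩
  · exact (FK_cont hGc R hκ).comp_continuousOn (continuousOn_log.mono (fun x hx => ne_of_gt hx))
  · have := FK_bound hC hR hm (Real.log x)
    rwa [exp_log hx] at this

lemma Ker.bdd {R : ℝ} {κ : ℝ → ℝ} (h : Ker R κ) : ∃ m, ∀ r, |κ r| ≤ m := by
  obtain ⟨m, hm⟩ := (isCompact_Icc (a := (0:ℝ)) (b := R)).exists_bound_of_continuousOn
    h.1.continuousOn
  refine ⟨max m 0, fun r => ?_⟩
  by_cases hr : r ∈ Ioo 0 R
  · exact (hm r (Ioo_subset_Icc_self hr)).trans (le_max_left _ _)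
  · rw [h.2 r hr, abs_zero]; exact le_max_right _ _

section main
variable {B F : ℝ → ℝ} {G : ℝ → ℝ → ℝ} {μp μm : ℝ → Measure ℝ}

lemma P_eq (hBc : ContinuousOn B (Ioi 0)) (hF : Continuous F)
    (heq : ∀ f f' : ℝ → ℝ, (∀ x > 0, HasDerivAt f (f' x) x) → ContinuousOn f' (Ioi 0) →
      (∃ C, ∀ x > 0, |f x| ≤ C * x) →
      (∃ C, ∀ x > 0, |x * f' x + B x * (2 * f (x / 2) - f x)| ≤ C * x) →
      ∀ t ≥ 0, LL (μp t) (μm t) f = LL (μp 0) (μm 0) f + ∫ s in (0:ℝ)..t,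
        LL (μp s) (μm s) (fun x => x * f' x + B x * (2 * f (x / 2) - f x)))
    (hGc : Continuous (fun p : ℝ × ℝ => G p.1 p.2)) {C : ℝ}
    (hC : ∀ t ≥ 0, ∀ u, |G t u| ≤ C * exp u)
    (hG : ∀ t ≥ 0, ∀ u, G t u = TT (fun v => B (exp v)) F G t u) {R : ℝ} (hR : 0 < R)
    {κ κ' : ℝ → ℝ}
    (hκ : Ker R κ) (hκ' : Ker R κ') (hd : ∀ r, HasDerivAt κ (κ' r) r) (t : ℝ) (ht : 0 ≤ t) :
    LL (μp t) (μm t) (XF G R κ) = LL (μp 0) (μm 0) (XF G R κ)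
      - ∫ s in (0:ℝ)..t, LL (μp s) (μm s) (XF G R κ') := by
  have hβ : Continuous (fun v => B (exp v)) :=
    hBc.comp_continuous (by fun_prop) (fun v => exp_pos v)
  obtain ⟨m, hm⟩ := hκ.bdd
  obtain ⟨m', hm'⟩ := hκ'.bdd
  have a1 := XF_adm hGc hC hR hκ.1 hm
  have a2 := XF_adm hGc hC hR hκ'.1 hm'
  have c1 : ContinuousOn (fun x => FK G R κ (Real.log x - Real.log 2)) (Ioi 0) :=
    (FK_cont hGc R hκ.1).comp_continuousOn
      ((continuousOn_log.mono (fun x hx => ne_of_gt hx)).sub continuousOn_const)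
  set f' : ℝ → ℝ := fun x => (-XF G R κ' x -
    B x * (2 * FK G R κ (Real.log x - Real.log 2) - XF G R κ x)) / x with hf'
  have e : ∀ x > 0, x * f' x + B x * (2 * XF G R κ (x / 2) - XF G R κ x) = -1 * XF G R κ' x := by
    intro x hx
    simp only [f']
    have : XF G R κ (x / 2) = FK G R κ (Real.log x - Real.log 2) := by
      unfold XF
      rw [Real.log_div hx.ne' two_ne_zero]
    rw [this]
    field_simp
    ring
  have := heq (XF G R κ) f' (fun x hx => by
      have h1 := (FK_deriv hβ hF hGc hG hR hκ hκ' hd (Real.log x)).comp x (Real.hasDerivAt_log hx.ne')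
      refine h1.congr_deriv ?_
      simp only [f', XF, exp_log hx]
      rw [div_eq_mul_inv])
    (by
      refine ContinuousOn.div ?_ continuousOn_id (fun x hx => ne_of_gt hx)
      exact a2.1.neg.sub (hBc.mul ((continuousOn_const.mul c1).sub a1.1)))
    ⟨_, a1.2⟩ ⟨_, fun x hx => by rw [e x hx, neg_one_mul, abs_neg]; exact a2.2 x hx⟩ t ht
  rw [this, sub_eq_add_neg, ← intervalIntegral.integral_neg]
  congr 2
  ext s
  rw [LL_congr e, LL_smul, neg_one_mul]

lemma taylor2 {κ κ' κ'' : ℝ → ℝ} (hd : ∀ r, HasDerivAt κ (κ' r) r)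
    (hd' : ∀ r, HasDerivAt κ' (κ'' r) r) {m : ℝ} (hm : ∀ r, |κ'' r| ≤ m) (a δ : ℝ) (hδ : 0 ≤ δ) :
    |κ (a + δ) - κ a - δ * κ' (a + δ)| ≤ m * δ ^ 2 := by
  have lip : ∀ x y, |κ' y - κ' x| ≤ m * |y - x| := by
    intro x y
    exact Convex.norm_image_sub_le_of_norm_hasDerivWithin_le (s := univ)
      (fun r _ => (hd' r).hasDerivWithinAt) (fun r _ => hm r) convex_univ (mem_univ x) (mem_univ y)
  have hm0 : 0 ≤ m := (abs_nonneg _).trans (hm 0)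
  have h := Convex.norm_image_sub_le_of_norm_hasDerivWithin_le (s := Icc a (a + δ)) (C := m * δ)
      (f := fun x => κ x - x * κ' (a + δ)) (f' := fun x => κ' x - 1 * κ' (a + δ)) (x := a)
      (y := a + δ)
      (fun r _ => ((hd r).sub ((hasDerivAt_id r).mul_const _)).hasDerivWithinAt)
      (fun r hr => by
        rw [one_mul, Real.norm_eq_abs]
        refine (lip _ _).trans ?_
        gcongr
        rw [abs_le]; constructor <;> linarith [hr.1, hr.2])
      (convex_Icc _ _) ⟨le_rfl, by linarith⟩ ⟨by linarith, le_rfl⟩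
  rw [Real.norm_eq_abs, Real.norm_eq_abs, add_sub_cancel_left, abs_of_nonneg hδ] at h
  refine le_trans (le_of_eq ?_) (h.trans (le_of_eq (by ring)))
  congr 1
  ring

lemma Ker.shift {R T s : ℝ} (hs : s ∈ Icc 0 T) {κ : ℝ → ℝ} (h : Ker R κ) :
    Ker (R + T) (fun r => κ (r - s)) := by
  refine ⟨by have := h.1; fun_prop, fun r hr => h.2 _ fun h' => hr ⟨?_, ?_⟩⟩
  · linarith [h'.1, hs.1]
  · linarith [h'.2, hs.2]

lemma main_shift (hBc : ContinuousOn B (Ioi 0)) (hF : Continuous F)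
    (hfin : ∀ t ≥ 0, (∫⁻ x in Ioi 0, ENNReal.ofReal x ∂(μp t)) < ⊤ ∧
      (∫⁻ x in Ioi 0, ENNReal.ofReal x ∂(μm t)) < ⊤)
    (hcont : ∀ f : ℝ → ℝ, ContinuousOn f (Ioi 0) → (∃ C, ∀ x > 0, |f x| ≤ C * x) →
      ContinuousOn (fun t => LL (μp t) (μm t) f) (Ici 0))
    (heq : ∀ f f' : ℝ → ℝ, (∀ x > 0, HasDerivAt f (f' x) x) → ContinuousOn f' (Ioi 0) →
      (∃ C, ∀ x > 0, |f x| ≤ C * x) →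
      (∃ C, ∀ x > 0, |x * f' x + B x * (2 * f (x / 2) - f x)| ≤ C * x) →
      ∀ t ≥ 0, LL (μp t) (μm t) f = LL (μp 0) (μm 0) f + ∫ s in (0:ℝ)..t,
        LL (μp s) (μm s) (fun x => x * f' x + B x * (2 * f (x / 2) - f x)))
    (hGc : Continuous (fun p : ℝ × ℝ => G p.1 p.2)) {C : ℝ}
    (hC : ∀ t ≥ 0, ∀ u, |G t u| ≤ C * exp u)
    (hG : ∀ t ≥ 0, ∀ u, G t u = TT (fun v => B (exp v)) F G t u) {R₀ : ℝ} (hR₀ : 0 < R₀)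
    {κ κ' κ'' : ℝ → ℝ} (hκ : Ker R₀ κ) (hκ' : Ker R₀ κ') (hκ'' : Ker R₀ κ'')
    (hd : ∀ r, HasDerivAt κ (κ' r) r) (hd' : ∀ r, HasDerivAt κ' (κ'' r) r) (T : ℝ) (hT : 0 ≤ T) :
    LL (μp T) (μm T) (XF G (R₀ + T) κ) =
      LL (μp 0) (μm 0) (XF G (R₀ + T) (fun r => κ (r - T))) := by
  obtain ⟨K, hK0, hK⟩ := LL_unif hfin hcont T
  obtain ⟨m, hm⟩ := hκ''.bdd
  set R := R₀ + T with hRdef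
  have hR : 0 < R := by linarith
  set A := C * exp R * R with hA
  set P : (ℝ → ℝ) → ℝ → ℝ := fun κ t => LL (μp t) (μm t) (XF G R κ) with hP
  have Pb : ∀ κ, Continuous κ → ∀ m, (∀ r, |κ r| ≤ m) → ∀ t ∈ Icc 0 T, |P κ t| ≤ K * (m * A) :=
    fun κ hκ m hm t ht => hK t ht _ _ (XF_adm hGc hC hR hκ hm)
  have Pc : ∀ κ, Ker R κ → ContinuousOn (P κ) (Ici 0) := by
    intro κ hκ
    obtain ⟨m, hm⟩ := hκ.bdd
    have := XF_adm hGc hC hR hκ.1 hm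
    exact hcont _ this.1 ⟨_, this.2⟩
  have Pint : ∀ κ, Ker R κ → ∀ a ≥ 0, ∀ b ≥ 0, IntervalIntegrable (P κ) volume a b := by
    intro κ hκ a ha b hb
    apply ContinuousOn.intervalIntegrable
    apply (Pc κ hκ).mono
    intro x hx
    exact le_trans (le_min ha hb) hx.1
  have Pdiff : ∀ κ κ', Ker R κ → Ker R κ' → (∀ r, HasDerivAt κ (κ' r) r) → ∀ a ≥ 0, ∀ b ≥ 0,
      P κ b - P κ a = -∫ s in a..b, P κ' s := by
    intro κ κ' h h' hd a ha b hb
    have h1 := P_eq hBc hF heq hGc hC hG hR h h' hd a ha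
    have h2 := P_eq hBc hF heq hGc hC hG hR h h' hd b hb
    have h3 := intervalIntegral.integral_add_adjacent_intervals
      (Pint κ' h' 0 le_rfl a ha) (Pint κ' h' a ha b hb)
    simp only [hP] at h3 ⊢
    linarith
  have Psub : ∀ κ₁ κ₂, Ker R κ₁ → Ker R κ₂ → ∀ t ≥ 0,
      P (fun r => κ₁ r - κ₂ r) t = P κ₁ t - P κ₂ t := by
    intro κ₁ κ₂ h1 h2 t ht
    obtain ⟨m1, hm1⟩ := h1.bdd
    obtain ⟨m2, hm2⟩ := h2.bdd
    simp only [hP]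
    rw [← LL_sub (hfin t ht).1 (hfin t ht).2 (XF_adm hGc hC hR h1.1 hm1)
      (XF_adm hGc hC hR h2.1 hm2)]
    congr 1; ext x
    exact FK_sub hGc R h1.1 h2.1 _
  have Psmul : ∀ c κ t, P (fun r => c * κ r) t = c * P κ t := by
    intro c κ t
    simp only [hP]
    rw [← LL_smul]
    congr 1; ext x
    exact FK_smul R c κ _
  have hA0 : 0 ≤ A := by
    have h0 : 0 ≤ C := by
      have := (abs_nonneg _).trans (hC 0 le_rfl 0)
      simpa using this
    positivity
  have hm0 : 0 ≤ m := (abs_nonneg _).trans (hm 0)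
  have fin := quad_const (e := fun t => P (fun r => κ (r - (T - t))) t) (C := 2 * (K * (m * A)))
    hT (by
    intro t ht t' ht' htt
    set δ := t' - t with hδ
    have hδ0 : 0 ≤ δ := by linarith
    have hs : T - t ∈ Icc 0 T := ⟨by linarith [ht.2], by linarith [ht.1]⟩
    have hs' : T - t' ∈ Icc 0 T := ⟨by linarith [ht'.2], by linarith [ht'.1]⟩
    have k1 := hκ.shift hs
    have k2 := hκ.shift hs'
    have k3 := hκ'.shift hs'
    have k4 := hκ''.shift hs'
    have dd : ∀ r, HasDerivAt (fun r => κ (r - (T - t'))) (κ' (r - (T - t'))) r :=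
      fun r => (hd _).comp_sub_const r _
    have dd' : ∀ r, HasDerivAt (fun r => κ' (r - (T - t'))) (κ'' (r - (T - t'))) r :=
      fun r => (hd' _).comp_sub_const r _
    have E1 := Pdiff _ _ k2 k3 dd t ht.1 t' ht'.1
    have k5 : Ker R (fun r => δ * κ' (r - (T - t'))) :=
      ⟨by have := hκ'.1; fun_prop, fun r hr => by simp only [k3.2 r hr, mul_zero]⟩
    have k6 : Ker R (fun r => κ (r - (T - t')) - κ (r - (T - t))) :=
      ⟨by have := hκ.1; fun_prop, fun r hr => by simp only [k1.2 r hr, k2.2 r hr, sub_zero]⟩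
    have E2 := Psub _ _ k6 k5 t ht.1
    rw [Psub _ _ k2 k1 t ht.1, Psmul] at E2
    have E3 : |P (fun r => κ (r - (T - t')) - κ (r - (T - t)) - δ * κ' (r - (T - t'))) t|
        ≤ K * (m * δ ^ 2 * A) := by
      apply Pb _ (by have := hκ'.1; have := hκ.1; fun_prop) _ _ t ht
      intro r
      have := taylor2 hd hd' hm (r - (T - t)) δ hδ0
      have e : r - (T - t) + δ = r - (T - t') := by rw [hδ]; ring
      rwa [e] at this
    have E4 : |∫ s in t..t', (P (fun r => κ' (r - (T - t'))) s - P (fun r => κ' (r - (T - t'))) t)|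
        ≤ (K * (m * A) * δ) * |t' - t| := by
      rw [← Real.norm_eq_abs]
      apply intervalIntegral.norm_integral_le_of_norm_le_const
      intro s hs
      rw [uIoc_of_le htt] at hs
      have hs0 : 0 ≤ s := ht.1.trans hs.1.le
      rw [Pdiff _ _ k3 k4 dd' t ht.1 s hs0, norm_neg]
      have : ‖∫ ρ in t..s, P (fun r => κ'' (r - (T - t'))) ρ‖ ≤ (K * (m * A)) * |s - t| := by
        apply intervalIntegral.norm_integral_le_of_norm_le_const
        intro ρ hρ
        rw [uIoc_of_le hs.1.le] at hρ
        exact Pb _ k4.1 m (fun r => hm _) ρ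
          ⟨ht.1.trans hρ.1.le, hρ.2.trans (hs.2.trans ht'.2)⟩
      refine this.trans ?_
      gcongr
      rw [abs_of_nonneg (by linarith [hs.1])]
      linarith [hs.2]
    rw [intervalIntegral.integral_sub (Pint _ k3 t ht.1 t' ht'.1) intervalIntegrable_const,
      intervalIntegral.integral_const, smul_eq_mul, ← hδ, abs_of_nonneg hδ0] at E4
    rw [E2] at E3
    rw [abs_le] at E3 E4 ⊢
    constructor <;> nlinarith [E3.1, E3.2, E4.1, E4.2])
  simp only [sub_self, sub_zero] at fin
  exact fin

end main


/-- approximate identity supported in `(0, 2/(n+1))` -/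
def AppId (k : ℕ → ℝ → ℝ) : Prop :=
  ∀ n, Ker 2 (k n) ∧ (∀ r, 0 ≤ k n r) ∧ (∫ r, k n r) = 1 ∧
    ∀ r, r ∉ Ioo 0 (2 / ((n:ℝ) + 1)) → k n r = 0

lemma kernels : ∃ k k' k'' : ℕ → ℝ → ℝ, AppId k ∧ ∀ n, Ker 2 (k' n) ∧ Ker 2 (k'' n) ∧
    (∀ r, HasDerivAt (k n) (k' n r) r) ∧ (∀ r, HasDerivAt (k' n) (k'' n r) r) := by
  have hpos : ∀ n : ℕ, 0 < 1 / ((n:ℝ) + 1) := fun n => by positivity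
  let b : ∀ n : ℕ, ContDiffBump (1 / ((n:ℝ) + 1)) := fun n =>
    ⟨1 / ((n:ℝ) + 1) / 4, 1 / ((n:ℝ) + 1) / 2, by have := hpos n; positivity,
      by have := hpos n; linarith⟩
  let k : ℕ → ℝ → ℝ := fun n => (b n).normed volume
  have ksm : ∀ n, ContDiff ℝ 2 (k n) := fun n => (b n).contDiff_normed
  have kts : ∀ n, tsupport (k n) ⊆ Ioo 0 (2 / ((n:ℝ) + 1)) := by
    intro n
    show tsupport ((b n).normed volume) ⊆ _
    rw [(b n).tsupport_normed_eq, Real.closedBall_eq_Icc]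
    show Icc (1 / ((n:ℝ) + 1) - 1 / ((n:ℝ) + 1) / 2) (1 / ((n:ℝ) + 1) + 1 / ((n:ℝ) + 1) / 2) ⊆ _
    have := hpos n
    have e : 2 / ((n:ℝ) + 1) = 2 * (1 / ((n:ℝ) + 1)) := by ring
    rw [e]
    intro r hr
    constructor <;> linarith [hr.1, hr.2]
  have hle : ∀ n : ℕ, Ioo 0 (2 / ((n:ℝ) + 1)) ⊆ Ioo 0 2 := by
    intro n
    apply Ioo_subset_Ioo_right
    apply div_le_self (by norm_num)
    have : (0:ℝ) ≤ n := Nat.cast_nonneg n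
    linarith
  have d1 : ∀ n, ContDiff ℝ 1 (deriv (k n)) := fun n =>
    ((contDiff_succ_iff_deriv (n := 1)).1 (ksm n)).2.2
  have d2 : ∀ n, Continuous (deriv (deriv (k n))) := fun n => (d1 n).continuous_deriv le_rfl
  have t1 : ∀ n, tsupport (deriv (k n)) ⊆ tsupport (k n) := fun n =>
    closure_minimal support_deriv_subset (isClosed_tsupport _)
  refine ⟨k, fun n => deriv (k n), fun n => deriv (deriv (k n)), ?_, ?_⟩
  · intro n
    refine ⟨⟨(ksm n).continuous, fun r hr => ?_⟩, fun r => (b n).nonneg_normed r,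
      (b n).integral_normed, fun r hr => ?_⟩
    · exact image_eq_zero_of_notMem_tsupport (fun h => hr (hle n (kts n h)))
    · exact image_eq_zero_of_notMem_tsupport (fun h => hr (kts n h))
  · intro n
    refine ⟨⟨(d1 n).continuous, fun r hr => ?_⟩, ⟨d2 n, fun r hr => ?_⟩, fun r => ?_, fun r => ?_⟩
    · exact image_eq_zero_of_notMem_tsupport (fun h => hr (hle n (kts n (t1 n h))))
    · by_contra h
      exact hr (hle n (kts n (t1 n (support_deriv_subset h))))
    · exact (((ksm n).differentiable (by norm_num)) r).hasDerivAt
    · exact (((d1 n).differentiable (by norm_num)) r).hasDerivAt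

lemma AppId.one {k : ℕ → ℝ → ℝ} (hk : AppId k) (n : ℕ) {s T : ℝ} (hs : s ∈ Icc 0 T) :
    ∫ r in (0:ℝ)..(2 + T), k n (r - s) = 1 := by
  have hK := (hk n).1.shift hs
  rw [intervalIntegral.integral_eq_integral_of_support_subset, integral_sub_right_eq_self (k n) s]
  · exact (hk n).2.2.1
  · intro r hr
    by_contra h
    exact hr (hK.2 r fun h' => h ⟨h'.1, h'.2.le⟩)

lemma AppId.lim {k : ℕ → ℝ → ℝ} (hk : AppId k) {s T : ℝ} (hs : s ∈ Icc 0 T) {g : ℝ → ℝ}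
    (hg : Continuous g) :
    Tendsto (fun n => ∫ r in (0:ℝ)..(2 + T), k n (r - s) * g r) atTop (𝓝 (g s)) := by
  have hT : 0 ≤ 2 + T := by linarith [hs.1, hs.2]
  rw [Metric.tendsto_atTop]
  intro η hη
  obtain ⟨δ, hδ, hgδ⟩ := Metric.continuous_iff.1 hg s (η / 2) (by positivity)
  obtain ⟨N, hN⟩ := exists_nat_gt (2 / δ)
  refine ⟨N, fun n hn => ?_⟩
  have hkc := (hk n).1.1
  have hn0 : (0:ℝ) < (n:ℝ) + 1 := by positivity
  have hsm : 2 / ((n:ℝ) + 1) < δ := by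
    rw [div_lt_iff₀ hn0]
    rw [div_lt_iff₀ hδ] at hN
    have : (N:ℝ) ≤ n := by exact_mod_cast hn
    nlinarith
  have e : (∫ r in (0:ℝ)..(2 + T), k n (r - s) * g r) - g s
      = ∫ r in (0:ℝ)..(2 + T), k n (r - s) * (g r - g s) := by
    simp only [mul_sub]
    rw [intervalIntegral.integral_sub (Continuous.intervalIntegrable (by fun_prop) _ _)
      (Continuous.intervalIntegrable (by fun_prop) _ _), intervalIntegral.integral_mul_const,
      hk.one n hs, one_mul]
  rw [dist_eq_norm, e]
  have : ‖∫ r in (0:ℝ)..(2 + T), k n (r - s) * (g r - g s)‖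
      ≤ ∫ r in (0:ℝ)..(2 + T), k n (r - s) * (η / 2) := by
    apply intervalIntegral.norm_integral_le_of_norm_le hT
    · refine Eventually.of_forall fun r _ => ?_
      rw [norm_mul, Real.norm_of_nonneg ((hk n).2.1 _)]
      by_cases h : r - s ∈ Ioo 0 (2 / ((n:ℝ) + 1))
      · apply mul_le_mul_of_nonneg_left _ ((hk n).2.1 _)
        rw [← dist_eq_norm]
        apply (hgδ r _).le
        rw [Real.dist_eq, abs_of_pos h.1]
        exact h.2.trans hsm
      · rw [(hk n).2.2.2 _ h, zero_mul, zero_mul]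
    · exact Continuous.intervalIntegrable (by fun_prop) _ _
  rw [intervalIntegral.integral_mul_const, hk.one n hs, one_mul] at this
  linarith

lemma AppId.bound {k : ℕ → ℝ → ℝ} (hk : AppId k) {s T : ℝ} (hs : s ∈ Icc 0 T) {G : ℝ → ℝ → ℝ}
    {C : ℝ} (hC : ∀ t ≥ 0, ∀ u, |G t u| ≤ C * exp u) (n : ℕ) (v : ℝ) :
    |FK G (2 + T) (fun r => k n (r - s)) v| ≤ C * exp (2 + T) * exp v := by
  have hT : 0 ≤ 2 + T := by linarith [hs.1, hs.2]
  have hkc := (hk n).1.1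
  have hC0 : 0 ≤ C := by
    have := (abs_nonneg _).trans (hC 0 le_rfl 0)
    simpa using this
  have : ‖FK G (2 + T) (fun r => k n (r - s)) v‖
      ≤ ∫ r in (0:ℝ)..(2 + T), k n (r - s) * (C * exp (2 + T) * exp v) := by
    apply intervalIntegral.norm_integral_le_of_norm_le hT
    · refine Eventually.of_forall fun r hr => ?_
      rw [norm_mul, Real.norm_of_nonneg ((hk n).2.1 _)]
      apply mul_le_mul_of_nonneg_left _ ((hk n).2.1 _)
      refine (hC r hr.1.le _).trans ?_
      rw [mul_assoc, ← exp_add]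
      exact mul_le_mul_of_nonneg_left (exp_le_exp.2 (by linarith [hr.2])) hC0
    · exact Continuous.intervalIntegrable (by fun_prop) _ _
  rwa [intervalIntegral.integral_mul_const, hk.one n hs, one_mul] at this

lemma LL_lim {k : ℕ → ℝ → ℝ} (hk : AppId k) {s T : ℝ} (hs : s ∈ Icc 0 T) {G : ℝ → ℝ → ℝ}
    (hGc : Continuous (fun p : ℝ × ℝ => G p.1 p.2))
    {C : ℝ} (hC : ∀ t ≥ 0, ∀ u, |G t u| ≤ C * exp u) {p m : Measure ℝ}
    (hp : ∫⁻ x in Ioi 0, ENNReal.ofReal x ∂p < ⊤)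
    (hm : ∫⁻ x in Ioi 0, ENNReal.ofReal x ∂m < ⊤) :
    Tendsto (fun n => LL p m (XF G (2 + T) (fun r => k n (r - s)))) atTop
      (𝓝 (LL p m (fun x => G s (Real.log x + s)))) := by
  have h : ∀ q : Measure ℝ, ∫⁻ x in Ioi 0, ENNReal.ofReal x ∂q < ⊤ →
      Tendsto (fun n => ∫ x in Ioi 0, XF G (2 + T) (fun r => k n (r - s)) x ∂q) atTop
      (𝓝 (∫ x in Ioi 0, G s (Real.log x + s) ∂q)) := by
    intro q hq
    refine tendsto_integral_of_dominated_convergence (fun x => C * exp (2 + T) * x) ?_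
      ((id_int hq).const_mul _) ?_ ?_
    · intro n
      have hkc := (hk n).1.1
      have : ContinuousOn (XF G (2 + T) (fun r => k n (r - s))) (Ioi 0) :=
        (FK_cont hGc _ (by fun_prop)).comp_continuousOn
          (continuousOn_log.mono (fun x hx => ne_of_gt hx))
      exact this.aestronglyMeasurable measurableSet_Ioi
    · intro n
      refine (ae_restrict_iff' measurableSet_Ioi).2 (Eventually.of_forall fun x hx => ?_)
      have := hk.bound hs hC n (Real.log x)
      rwa [exp_log hx] at this
    · refine Eventually.of_forall fun x => ?_
      have hc : Continuous (fun r : ℝ => G r (Real.log x + r)) :=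
        hGc.comp (by fun_prop : Continuous fun r : ℝ => (r, Real.log x + r))
      exact hk.lim hs hc
  exact (h p hp).sub (h m hm)

lemma lin_bdd {f : ℝ → ℝ} (hf : ContinuousOn f (Ioi 0))
    (h0 : Tendsto (fun x => f x / x) (nhdsWithin 0 (Ioi 0)) (nhds 0))
    (h1 : Tendsto (fun x => f x / x) atTop (nhds 0)) : ∃ C, ∀ x > 0, |f x| ≤ C * x := by
  have e0 : ∀ᶠ x in nhdsWithin 0 (Ioi 0), |f x / x| < 1 := by
    have := h0.abs
    rw [abs_zero] at this
    exact this.eventually (gt_mem_nhds one_pos)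
  have e1 : ∀ᶠ x in atTop, |f x / x| < 1 := by
    have := h1.abs
    rw [abs_zero] at this
    exact this.eventually (gt_mem_nhds one_pos)
  obtain ⟨a, ha, hA⟩ := mem_nhdsGT_iff_exists_Ioo_subset.1 e0
  obtain ⟨b, hb⟩ := eventually_atTop.1 e1
  have ha' : 0 < a := ha
  have hc : ContinuousOn (fun x => f x / x) (Icc a b) :=
    (hf.mono fun x hx => ha'.trans_le hx.1).div continuousOn_id fun x hx => (ha'.trans_le hx.1).ne'
  obtain ⟨D, hD⟩ := isCompact_Icc.exists_bound_of_continuousOn hc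
  refine ⟨max D 1, fun x hx => ?_⟩
  have : |f x / x| ≤ max D 1 := by
    rcases lt_or_ge x a with h | h
    · exact (le_of_lt (hA ⟨hx, h⟩)).trans (le_max_right _ _)
    rcases lt_or_ge x b with h' | h'
    · exact (hD x ⟨h, h'.le⟩).trans (le_max_left _ _)
    · exact (hb x h').le.trans (le_max_right _ _)
  rwa [abs_div, abs_of_pos hx, div_le_iff₀ hx] at this

lemma mild_log {B f : ℝ → ℝ} {φ : ℝ → ℝ → ℝ} (h : IsMildSol B f φ)
    (hBc : ContinuousOn B (Ioi 0)) (t : ℝ) (ht : 0 ≤ t) (u : ℝ) :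
    φ t (exp (u - t)) = TT (fun v => B (exp v)) (fun v => f (exp v))
      (fun t u => φ t (exp (u - t))) t u := by
  have hβ : Continuous (fun v => B (exp v)) :=
    hBc.comp_continuous (by fun_prop) (fun v => exp_pos v)
  set β := fun v => B (exp v) with hβd
  have hS : ∀ τ, ∫ s in (0:ℝ)..τ, B (exp (u - t) * exp s) = SS β t u - SS β (t - τ) u := by
    intro τ
    have e1 : ∀ s, B (exp (u - t) * exp s) = β (u - (t - s)) := by
      intro s
      rw [← exp_add, hβd]
      congr 2; ring
    simp only [e1]
    rw [intervalIntegral.integral_comp_sub_left (fun r => β (u - r)) t, sub_zero]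
    have hc : Continuous (fun r => β (u - r)) := by fun_prop
    unfold SS
    rw [intervalIntegral.integral_interval_sub_left (hc.intervalIntegrable _ _)
      (hc.intervalIntegrable _ _)]
  rw [h t ht (exp (u - t)) (exp_pos _), hS t]
  simp only [hS]
  have e2 : ∀ τ, B (exp (u - t) * exp τ) * exp (-(SS β t u - SS β (t - τ) u)) *
      φ (t - τ) (exp (u - t) * exp τ / 2) =
      (fun σ => exp (-SS β t u) * (β (u - σ) * exp (SS β σ u) *
        φ σ (exp (u - Real.log 2 - σ)))) (t - τ) := by
    intro τ
    have a1 : exp (u - t) * exp τ = exp (u - (t - τ)) := by rw [← exp_add]; congr 1; ring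
    have a2 : exp (u - (t - τ)) / 2 = exp (u - Real.log 2 - (t - τ)) := by
      rw [show u - Real.log 2 - (t - τ) = u - (t - τ) - Real.log 2 by ring, exp_sub _ (Real.log 2),
        exp_log two_pos]
    have a3 : exp (-(SS β t u - SS β (t - τ) u)) = exp (-SS β t u) * exp (SS β (t - τ) u) := by
      rw [← exp_add]; congr 1; ring
    simp only
    rw [a1, a2, a3, hβd]
    ring
  simp only [e2]
  rw [intervalIntegral.integral_comp_sub_left (fun σ => exp (-SS β t u) * (β (u - σ) *
    exp (SS β σ u) * φ σ (exp (u - Real.log 2 - σ)))) t, sub_self, sub_zero,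
    intervalIntegral.integral_const_mul, SS_zero, sub_zero, ← exp_add, sub_add_cancel]
  simp only [TT]
  ring

lemma B_bdd {B : ℝ → ℝ} (hB : Bhyp B) (r : ℝ) : ∃ K, ∀ v ≤ r, B (exp v) ≤ K := by
  obtain ⟨hc, _, ε, hε, C, hC⟩ := hB
  obtain ⟨D, hD⟩ := (isCompact_Icc (a := ε) (b := exp r)).exists_bound_of_continuousOn
    (hc.mono fun x hx => hε.trans_le hx.1)
  refine ⟨max C D, fun v hv => ?_⟩
  rcases lt_or_ge (exp v) ε with h | h
  · exact (hC _ (exp_pos v) h).trans (le_max_left _ _)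
  · exact (le_abs_self _).trans ((hD _ ⟨h, exp_le_exp.2 hv⟩).trans (le_max_right _ _))


/-- Uniqueness of measure solutions: any measure solution `(µ_t)` (given by a family of pairs of
positive measures `µ_t = µpₜ - µmₜ`) of the mitosis equation satisfies
`µ_t(f) = µ₀(M_t f) = µ₀⁺(M_t f) - µ₀⁻(M_t f)` for every `t ≥ 0` and every continuous `f`
with `f(x)/x → 0` at `0` and `∞`. -/
theorem stmt8 (B : ℝ → ℝ) (hB : Bhyp B)
    (M : (ℝ → ℝ) → ℝ → ℝ → ℝ)
    (hM : ∀ f, LocBddOn f → LocBdd2 (M f) ∧ IsMildSol B f (M f))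
    (μp μm : ℝ → Measure ℝ)
    (hfin : ∀ t ≥ 0, (∫⁻ x in Ioi 0, ENNReal.ofReal x ∂(μp t)) < ⊤ ∧
      (∫⁻ x in Ioi 0, ENNReal.ofReal x ∂(μm t)) < ⊤)
    (hcont : ∀ f : ℝ → ℝ, ContinuousOn f (Ioi 0) → (∃ C, ∀ x > 0, |f x| ≤ C * x) →
      ContinuousOn
        (fun t => (∫ x in Ioi 0, f x ∂(μp t)) - ∫ x in Ioi 0, f x ∂(μm t)) (Ici 0))
    (heq : ∀ f f' : ℝ → ℝ, (∀ x > 0, HasDerivAt f (f' x) x) → ContinuousOn f' (Ioi 0) →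
      (∃ C, ∀ x > 0, |f x| ≤ C * x) →
      (∃ C, ∀ x > 0, |x * f' x + B x * (2 * f (x / 2) - f x)| ≤ C * x) →
      ∀ t ≥ 0,
        (∫ x in Ioi 0, f x ∂(μp t)) - (∫ x in Ioi 0, f x ∂(μm t))
          = ((∫ x in Ioi 0, f x ∂(μp 0)) - ∫ x in Ioi 0, f x ∂(μm 0))
            + ∫ s in (0:ℝ)..t,
                ((∫ x in Ioi 0, (x * f' x + B x * (2 * f (x / 2) - f x)) ∂(μp s))
                  - ∫ x in Ioi 0, (x * f' x + B x * (2 * f (x / 2) - f x)) ∂(μm s))) :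
    ∀ t ≥ 0, ∀ f : ℝ → ℝ, ContinuousOn f (Ioi 0) →
      Tendsto (fun x => f x / x) (nhdsWithin 0 (Ioi 0)) (nhds 0) →
      Tendsto (fun x => f x / x) atTop (nhds 0) →
      (∫ x in Ioi 0, f x ∂(μp t)) - (∫ x in Ioi 0, f x ∂(μm t))
        = (∫ x in Ioi 0, M f t x ∂(μp 0)) - ∫ x in Ioi 0, M f t x ∂(μm 0) := by
  intro T hT f hf h0 h1
  obtain ⟨C, hC⟩ := lin_bdd hf h0 h1
  have hC0 : 0 ≤ C := by
    have := (abs_nonneg _).trans (hC 1 one_pos)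
    simpa using this
  have hloc : LocBddOn f := fun r hr => ⟨C * r, fun x hx hxr => (hC x hx).trans (by gcongr)⟩
  obtain ⟨hb2, hmild⟩ := hM f hloc
  have hBc := hB.1
  have hβ : Continuous (fun v => B (exp v)) :=
    hBc.comp_continuous (by fun_prop) (fun v => exp_pos v)
  have hβ0 : ∀ v, 0 ≤ (fun v => B (exp v)) v := fun v => hB.2.1 _ (exp_pos v)
  have hK := B_bdd hB
  set F : ℝ → ℝ := fun v => f (exp v) with hFd
  have hF : Continuous F := hf.comp_continuous (by fun_prop) (fun v => exp_pos v)
  have hFC : ∀ u, |F u| ≤ C * exp u := fun u => hC _ (exp_pos u)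
  set G₀ : ℝ → ℝ → ℝ := fun t u => M f t (exp (u - t)) with hG₀d
  have hG₀ : ∀ t ≥ 0, ∀ u, G₀ t u = TT (fun v => B (exp v)) F G₀ t u :=
    fun t ht u => mild_log hmild hBc t ht u
  have hb : ∀ r, ∃ D, ∀ t u, 0 ≤ t → t ≤ r → u ≤ r → |G₀ t u| ≤ D := by
    intro r
    obtain ⟨D, hD⟩ := hb2 (exp r) (exp_pos r)
    refine ⟨D, fun t u ht htr hur => hD t _ ht ?_ (exp_pos _) ?_⟩
    · have := add_one_le_exp r
      linarith
    · exact exp_le_exp.2 (by linarith)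
  have c0 := G_cont hβ hβ0 hF hK hG₀ hb
  have b0 := G_bound hβ hβ0 hF hK hG₀ hb hFC
  set G : ℝ → ℝ → ℝ := fun t u => G₀ (max t 0) u with hGd
  have hGG : ∀ t ≥ 0, ∀ u, G t u = G₀ t u := fun t ht u => by simp only [hGd, max_eq_left ht]
  have hGc : Continuous (fun p : ℝ × ℝ => G p.1 p.2) :=
    c0.comp_continuous (by fun_prop : Continuous fun p : ℝ × ℝ => (max p.1 0, p.2))
      (fun p => ⟨mem_Ici.2 (le_max_right _ _), mem_univ _⟩)
  have hGb : ∀ t ≥ 0, ∀ u, |G t u| ≤ C * exp u := fun t ht u => by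
    rw [hGG t ht]; exact b0 t ht u
  have hG : ∀ t ≥ 0, ∀ u, G t u = TT (fun v => B (exp v)) F G t u := by
    intro t ht u
    rw [hGG t ht, hG₀ t ht]
    unfold TT
    congr 3
    apply intervalIntegral.integral_congr
    intro σ hσ
    rw [uIcc_of_le ht] at hσ
    simp only
    rw [hGG σ hσ.1]
  obtain ⟨k, k', k'', hk, hk2⟩ := kernels
  have key : ∀ n, LL (μp T) (μm T) (XF G (2 + T) (fun r => k n (r - 0))) =
      LL (μp 0) (μm 0) (XF G (2 + T) (fun r => k n (r - T))) := by
    intro n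
    simp only [sub_zero]
    exact main_shift hBc hF hfin hcont heq hGc hGb hG two_pos (hk n).1 (hk2 n).1 (hk2 n).2.1
      (hk2 n).2.2.1 (hk2 n).2.2.2 T hT
  have l1 := LL_lim hk (s := 0) (T := T) ⟨le_rfl, hT⟩ hGc hGb (hfin T hT).1 (hfin T hT).2
  have l2 := LL_lim hk (s := T) (T := T) ⟨hT, le_rfl⟩ hGc hGb (hfin 0 le_rfl).1 (hfin 0 le_rfl).2
  simp only [key] at l1
  have e := tendsto_nhds_unique l1 l2
  have e1 : LL (μp T) (μm T) (fun x => G 0 (Real.log x + 0)) = LL (μp T) (μm T) f := by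
    apply LL_congr
    intro x hx
    rw [hG 0 le_rfl]
    simp [TT, SS_zero, hFd, exp_log hx]
  have e2 : LL (μp 0) (μm 0) (fun x => G T (Real.log x + T)) = LL (μp 0) (μm 0) (M f T) := by
    apply LL_congr
    intro x hx
    rw [hGG T hT]
    simp [hG₀d, exp_log hx]
  rw [e1, e2] at e
  exact e
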